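/- Let V be a finite set and let λ : V × V → ℝ≥0 be symmetric (λ_{i,j} = λ_{j,i}). Define the cut capacity c_λ(X) = Σ_{i ∈ X, j ∈ V\X} λ_{i,j} for X ⊆ V. Suppose T₁ is a tree on V with the Gomory–Hu property for c_λ: for every edge e = {u,v} of T₁, with C_e the connected component of u in T₁ − e, c_λ(C_e) = min{ c_λ(W) : W ⊆ V, |W ∩ {u,v}| = 1 }. Then for every tree T₂ on V, Σ_{e ∈ E(T₁)} (c_λ(C_e))^{1/3} ≤ Σ_{e' ∈ E(T₂)} (c_λ(C_{e'}))^{1/3}. -/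

import Mathlib

open Finset
open scoped Classical

theorem SimpleGraph.Connected.reachable_deleteEdges_or {V : Type*} {G : SimpleGraph V}
    (hG : G.Connected) (x y w : V) :
    (G.deleteEdges {s(x, y)}).Reachable x w ∨ (G.deleteEdges {s(x, y)}).Reachable y w := by
  suffices h : ∀ z, G.Walk w z → (G.deleteEdges {s(x, y)}).Reachable x z →
      (G.deleteEdges {s(x, y)}).Reachable x w ∨ (G.deleteEdges {s(x, y)}).Reachable y w by
    obtain ⟨p⟩ := hG.preconnected w x
    exact h x p .rfl
  intro z p hz
  induction p with
  | nil => exact Or.inl hz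
  | @cons a b _ hab _ ih =>
    specialize ih hz
    by_cases he : s(a, b) = s(x, y)
    · rcases Sym2.eq_iff.mp he with ⟨rfl, -⟩ | ⟨rfl, -⟩
      · exact Or.inl .rfl
      · exact Or.inr .rfl
    · have hba : (G.deleteEdges {s(x, y)}).Adj b a := by
        rw [SimpleGraph.deleteEdges_adj]
        exact ⟨hab.symm, by rwa [Set.mem_singleton_iff, Sym2.eq_swap]⟩
      exact ih.imp (·.trans hba.reachable) (·.trans hba.reachable)

theorem SimpleGraph.IsAcyclic.not_reachable_deleteEdges_of_mem_edges {V : Type*}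
    {G : SimpleGraph V} (hG : G.IsAcyclic) {u v : V} {p : G.Walk u v} (hp : p.IsPath)
    {e : Sym2 V} (he : e ∈ p.edges) : ¬ (G.deleteEdges {e}).Reachable u v := by
  intro h
  obtain ⟨q, hq⟩ := h.exists_isPath
  have hpq := congrArg Subtype.val
    ((hG.subsingleton_path u v).elim ⟨p, hp⟩ ⟨q.mapLe (G.deleteEdges_le {e}), hq.mapLe _⟩)
  dsimp only at hpq
  rw [hpq, SimpleGraph.Walk.edges_mapLe_eq_edges] at he
  have := q.edges_subset_edgeSet he
  simp [SimpleGraph.edgeSet_deleteEdges] at this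

theorem SimpleGraph.IsTree.xor_reachable_deleteEdges_of_mem_edges {V : Type*}
    {G : SimpleGraph V} (hG : G.IsTree) {u v x y : V} {p : G.Walk u v} (hp : p.IsPath)
    (he : s(x, y) ∈ p.edges) :
    Xor ((G.deleteEdges {s(x, y)}).Reachable x u) ((G.deleteEdges {s(x, y)}).Reachable x v) := by
  have huv := hG.isAcyclic.not_reachable_deleteEdges_of_mem_edges hp he
  have hu := hG.connected.reachable_deleteEdges_or x y u
  have hv := hG.connected.reachable_deleteEdges_or x y v
  have hx : ¬ ((G.deleteEdges {s(x, y)}).Reachable x u ∧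
      (G.deleteEdges {s(x, y)}).Reachable x v) := fun h ↦ huv (h.1.symm.trans h.2)
  have hy : ¬ ((G.deleteEdges {s(x, y)}).Reachable y u ∧
      (G.deleteEdges {s(x, y)}).Reachable y v) := fun h ↦ huv (h.1.symm.trans h.2)
  unfold Xor
  tauto

/-- Replacing the edges `A` of a tree by a set `N` of edges that still connects the endpoints of
each edge of `A` leaves a connected graph, so `N` is at least as large as `A`. -/
theorem SimpleGraph.IsTree.card_le_card_of_reachable {V : Type*} [Fintype V]
    {T : SimpleGraph V} (hT : T.IsTree) {A N : Finset (Sym2 V)} (hA : A ⊆ T.edgeFinset)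
    (h : ∀ u v, s(u, v) ∈ A → (SimpleGraph.fromEdgeSet (N : Set (Sym2 V))).Reachable u v) :
    #A ≤ #N := by
  set G := SimpleGraph.fromEdgeSet (((T.edgeFinset \ A) ∪ N : Finset (Sym2 V)) : Set (Sym2 V))
    with hGdef
  have hadj : ∀ u v, T.Adj u v → G.Reachable u v := by
    intro u v huv
    by_cases hm : s(u, v) ∈ A
    · exact (h u v hm).mono (SimpleGraph.fromEdgeSet_mono (by simp))
    · refine SimpleGraph.Adj.reachable ?_
      rw [hGdef, SimpleGraph.fromEdgeSet_adj]
      exact ⟨by simp [huv, hm], huv.ne⟩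
  have hG : G.Connected := by
    have := hT.connected.nonempty
    refine ⟨fun u v ↦ ?_⟩
    obtain ⟨p⟩ := hT.connected.preconnected u v
    induction p with
    | nil => exact .rfl
    | cons hab _ ih => exact (hadj _ _ hab).trans ih
  have hcard := hG.card_vert_le_card_edgeSet_add_one
  have hsub : Nat.card G.edgeSet ≤ #((T.edgeFinset \ A) ∪ N) := by
    rw [← Set.ncard_coe_finset, ← Nat.card_coe_set_eq]
    refine Nat.card_mono (Finset.finite_toSet _) ?_
    rw [hGdef, SimpleGraph.edgeSet_fromEdgeSet]
    exact Set.sdiff_subset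
  have hunion := Finset.card_union_le (T.edgeFinset \ A) N
  have hsdiff := Finset.card_sdiff_add_card_eq_card hA
  have htree := hT.card_edgeFinset
  rw [Nat.card_eq_fintype_card] at hcard
  omega

/-- There is an injection between the edge sets of two trees such that the path in `T₂` between
the endpoints of each edge of `T₁` contains the image of that edge. -/
theorem SimpleGraph.IsTree.exists_injective_mem_edges {V : Type*} [Fintype V]
    {T₁ T₂ : SimpleGraph V} (h1 : T₁.IsTree) (h2 : T₂.IsTree) :
    ∃ f : T₁.edgeFinset → Sym2 V, Function.Injective f ∧
      ∀ e, ∃ (u v : V) (p : T₂.Walk u v), p.IsPath ∧ e.1 = s(u, v) ∧ f e ∈ p.edges := by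
  let t : T₁.edgeFinset → Finset (Sym2 V) := fun e ↦
    Finset.univ.filter fun e' ↦
      ∃ (u v : V) (p : T₂.Walk u v), p.IsPath ∧ e.1 = s(u, v) ∧ e' ∈ p.edges
  suffices hall : ∀ s : Finset T₁.edgeFinset, #s ≤ #(s.biUnion t) by
    obtain ⟨f, hf, hft⟩ :=
      (Finset.all_card_le_biUnion_card_iff_exists_injective t).mp hall
    exact ⟨f, hf, fun e ↦ (Finset.mem_filter.mp (hft e)).2⟩
  intro s
  rw [← Finset.card_map (Function.Embedding.subtype _)]
  refine h1.card_le_card_of_reachable (fun e he ↦ ?_) fun u v huv ↦ ?_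
  · obtain ⟨a, -, rfl⟩ := Finset.mem_map.mp he
    exact a.2
  · obtain ⟨e, he, heq⟩ := Finset.mem_map.mp huv
    obtain ⟨p, hp, -⟩ := h2.existsUnique_path u v
    refine ⟨p.transfer _ fun e' he' ↦ ?_⟩
    rw [SimpleGraph.edgeSet_fromEdgeSet]
    refine ⟨?_, T₂.not_isDiag_of_mem_edgeSet (p.edges_subset_edgeSet he')⟩
    exact Finset.mem_biUnion.mpr
      ⟨e, he, Finset.mem_filter.mpr ⟨Finset.mem_univ _, u, v, p, hp, heq, he'⟩⟩

/-- A Gomory–Hu tree `T₁` for the cut-capacity function `c_λ` minimizes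
`∑_{e ∈ T} (c_λ(C_e))^{1/3}` over all trees `T` on `V`. -/
theorem stmt9 {V : Type*} [Fintype V]
    (lam : V → V → ℝ) (hnn : ∀ i j, 0 ≤ lam i j) (hsym : ∀ i j, lam i j = lam j i)
    (c : Set V → ℝ)
    (hc : ∀ X : Set V, c X =
      ∑ i ∈ Finset.univ.filter (· ∈ X), ∑ j ∈ Finset.univ.filter (· ∉ X), lam i j)
    (T₁ T₂ : SimpleGraph V) (h1 : T₁.IsTree) (h2 : T₂.IsTree)
    (C₁ C₂ : Sym2 V → Set V)
    (hC₁ : ∀ u v : V, T₁.Adj u v →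
      C₁ s(u, v) = {x | (T₁.deleteEdges {s(u, v)}).Reachable u x} ∨
      C₁ s(u, v) = {x | (T₁.deleteEdges {s(u, v)}).Reachable v x})
    (hC₂ : ∀ u v : V, T₂.Adj u v →
      C₂ s(u, v) = {x | (T₂.deleteEdges {s(u, v)}).Reachable u x} ∨
      C₂ s(u, v) = {x | (T₂.deleteEdges {s(u, v)}).Reachable v x})
    (hGH : ∀ u v : V, T₁.Adj u v →
      IsLeast {r : ℝ | ∃ W : Set V, Xor' (u ∈ W) (v ∈ W) ∧ r = c W} (c (C₁ s(u, v)))) :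
    ∑ e ∈ T₁.edgeFinset, c (C₁ e) ^ ((1 : ℝ) / 3)
      ≤ ∑ e ∈ T₂.edgeFinset, c (C₂ e) ^ ((1 : ℝ) / 3) := by
  have hc0 : ∀ X, 0 ≤ c X := fun X ↦ by
    rw [hc]
    exact Finset.sum_nonneg fun i _ ↦ Finset.sum_nonneg fun j _ ↦ hnn i j
  obtain ⟨f, hf, hfp⟩ := h1.exists_injective_mem_edges h2
  have hmem : ∀ e, f e ∈ T₂.edgeFinset := fun e ↦ by
    obtain ⟨_, _, p, -, -, hp⟩ := hfp e
    exact SimpleGraph.mem_edgeFinset.mpr (p.edges_subset_edgeSet hp)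
  have hle : ∀ e : T₁.edgeFinset, c (C₁ e) ≤ c (C₂ (f e)) := fun e ↦ by
    obtain ⟨u, v, p, hp, he, hfe⟩ := hfp e
    have huv : T₁.Adj u v := by
      rw [← SimpleGraph.mem_edgeSet, ← he]
      exact SimpleGraph.mem_edgeFinset.mp e.2
    rw [he]
    refine (hGH u v huv).2 ⟨_, ?_, rfl⟩
    generalize f e = e' at hfe
    induction e' using Sym2.ind with
    | _ x y =>
      rcases hC₂ x y (p.edges_subset_edgeSet hfe) with h | h <;> rw [h]
      · exact h2.xor_reachable_deleteEdges_of_mem_edges hp hfe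
      · rw [Sym2.eq_swap] at hfe ⊢
        exact h2.xor_reachable_deleteEdges_of_mem_edges hp hfe
  calc ∑ e ∈ T₁.edgeFinset, c (C₁ e) ^ ((1 : ℝ) / 3)
      = ∑ e : T₁.edgeFinset, c (C₁ e) ^ ((1 : ℝ) / 3) :=
        (Finset.sum_coe_sort T₁.edgeFinset fun e ↦ c (C₁ e) ^ ((1 : ℝ) / 3)).symm
    _ ≤ ∑ e : T₁.edgeFinset, c (C₂ (f e)) ^ ((1 : ℝ) / 3) :=
        Finset.sum_le_sum fun e _ ↦ Real.rpow_le_rpow (hc0 _) (hle e) (by norm_num)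
    _ = ∑ e ∈ Finset.univ.map ⟨f, hf⟩, c (C₂ e) ^ ((1 : ℝ) / 3) := by
        rw [Finset.sum_map, Function.Embedding.coeFn_mk]
    _ ≤ ∑ e ∈ T₂.edgeFinset, c (C₂ e) ^ ((1 : ℝ) / 3) := by
        refine Finset.sum_le_sum_of_subset_of_nonneg (fun e he ↦ ?_)
          fun e _ _ ↦ Real.rpow_nonneg (hc0 _) _
        obtain ⟨a, -, rfl⟩ := Finset.mem_map.mp he
        exact hmem a
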